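/- Let α, β > -1 be real numbers with max{α, β} ≥ -1/2, and let f ∈ L_{(α,β)}. Then ∫_0^π f(θ) P_k^{(α,β)}(cos θ) (sin(θ/2))^{2α+1} (cos(θ/2))^{2β+1} dθ = o(k^{max{α,β}}) as k → ∞. -/

import Mathlib

open MeasureTheory Filter Set

noncomputable section

/-- Generalized binomial coefficient `C(a, m) = Γ(a+1)/(Γ(m+1)Γ(a-m+1))`. -/
def genBinom (a : ℝ) (m : ℕ) : ℝ :=
  Real.Gamma (a + 1) / (Real.Gamma ((m : ℝ) + 1) * Real.Gamma (a - (m : ℝ) + 1))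

/-- The Jacobi polynomial `P_k^{(α,β)}(x)`. -/
def jacobiP (α β : ℝ) (k : ℕ) (x : ℝ) : ℝ :=
  ∑ s ∈ Finset.range (k + 1),
    genBinom ((k : ℝ) + α) (k - s) * genBinom ((k : ℝ) + β) s *
      ((x - 1) / 2) ^ s * ((x + 1) / 2) ^ (k - s)

/-- The normalized Jacobi polynomial `R_k^{(α,β)}(x) = P_k^{(α,β)}(x)/P_k^{(α,β)}(1)`. -/
def jacobiR (α β : ℝ) (k : ℕ) (x : ℝ) : ℝ := jacobiP α β k x / jacobiP α β k 1

/-- The Jacobi weight `(sin(θ/2))^{2α+1} (cos(θ/2))^{2β+1}`. -/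
def jacobiWeight (α β : ℝ) (θ : ℝ) : ℝ :=
  Real.sin (θ / 2) ^ (2 * α + 1) * Real.cos (θ / 2) ^ (2 * β + 1)

/-- `f ∈ L_{(α,β)}`: `f` is integrable on `[0,π]` against the Jacobi weight. -/
def MemJacobiL (α β : ℝ) (f : ℝ → ℝ) : Prop :=
  IntegrableOn (fun θ => f θ * jacobiWeight α β θ) (Ioc 0 Real.pi)

/-- The norm `‖f‖_{L_{(α,β)}}`. -/
def jacobiNorm (α β : ℝ) (f : ℝ → ℝ) : ℝ :=
  ∫ θ in Ioc (0 : ℝ) Real.pi, |f θ| * jacobiWeight α β θ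

/-- The `k`-th Fourier–Jacobi coefficient `f̂_{(α,β)}(k)`. -/
def fourierJacobi (α β : ℝ) (f : ℝ → ℝ) (k : ℕ) : ℝ :=
  ∫ θ in Ioc (0 : ℝ) Real.pi, f θ * jacobiR α β k (Real.cos θ) * jacobiWeight α β θ

end

section Jacobi

open Polynomial

variable {α β : ℝ}

theorem sub_natCast_mul_succ_mul_genBinom (a : ℝ) (m : ℕ) (h : 0 < a - m) :
    ((m : ℝ) + 1) * genBinom a (m + 1) = (a - m) * genBinom a m := by
  have h1 : Real.Gamma (a - m + 1) = (a - m) * Real.Gamma (a - m) := Real.Gamma_add_one h.ne'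
  have h2 : Real.Gamma ((m : ℝ) + 1 + 1) = (m + 1) * Real.Gamma ((m : ℝ) + 1) :=
    Real.Gamma_add_one (by positivity)
  have h3 : Real.Gamma (a - m) ≠ 0 := (Real.Gamma_pos_of_pos h).ne'
  have h4 : Real.Gamma ((m : ℝ) + 1) ≠ 0 := (Real.Gamma_pos_of_pos (by positivity)).ne'
  have h5 : a - m ≠ 0 := h.ne'
  have h6 : (m : ℝ) + 1 ≠ 0 := by positivity
  simp only [genBinom, Nat.cast_add, Nat.cast_one]
  rw [show a - ((m : ℝ) + 1) + 1 = a - m by ring, h1, h2]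
  field_simp

/-- The coefficients of the Jacobi polynomial in the variables `(x - 1) / 2`, `(x + 1) / 2`. -/
noncomputable def jacobiCoeff (α β : ℝ) (k s : ℕ) : ℝ :=
  genBinom ((k : ℝ) + α) (k - s) * genBinom ((k : ℝ) + β) s

theorem jacobiCoeff_succ (hα : -1 < α) (hβ : -1 < β) {k s : ℕ} (hs : s < k) :
    ((s : ℝ) + 1) * (s + 1 + α) * jacobiCoeff α β k (s + 1)
      = (k - s) * (k - s + β) * jacobiCoeff α β k s := by
  obtain ⟨m, rfl⟩ := Nat.exists_eq_add_of_lt hs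
  have e1 : s + m + 1 - s = m + 1 := by omega
  have e2 : s + m + 1 - (s + 1) = m := by omega
  have h1 := sub_natCast_mul_succ_mul_genBinom (((s + m + 1 : ℕ) : ℝ) + α) m
    (by push_cast; have : (0 : ℝ) ≤ s := s.cast_nonneg; linarith)
  have h2 := sub_natCast_mul_succ_mul_genBinom (((s + m + 1 : ℕ) : ℝ) + β) s
    (by push_cast; have : (0 : ℝ) ≤ m := m.cast_nonneg; linarith)
  simp only [jacobiCoeff, e1, e2]
  push_cast at h1 h2 ⊢
  linear_combination (genBinom (↑s + ↑m + 1 + α) m) * (s + 1 + α) * h2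
    - (m + 1 + β) * genBinom (↑s + ↑m + 1 + β) s * h1

/-- The Jacobi differential operator. -/
noncomputable def jacobiOp (α β : ℝ) (p : ℝ[X]) : ℝ[X] :=
  (1 - X ^ 2) * derivative (derivative p) + (C (β - α) - C (α + β + 2) * X) * derivative p

/-- The products `((x - 1) / 2) ^ m * ((x + 1) / 2) ^ n`. -/
noncomputable def bernsteinTerm (m n : ℕ) : ℝ[X] :=
  (C (1 / 2) * (X - 1)) ^ m * (C (1 / 2) * (X + 1)) ^ n

theorem jacobiOp_sum {ι : Type*} (s : Finset ι) (c : ι → ℝ) (p : ι → ℝ[X]) :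
    jacobiOp α β (∑ i ∈ s, C (c i) * p i) = ∑ i ∈ s, C (c i) * jacobiOp α β (p i) := by
  simp only [jacobiOp, derivative_sum, derivative_C_mul, Finset.mul_sum, ← Finset.sum_add_distrib]
  exact Finset.sum_congr rfl fun i _ => by ring

theorem jacobiOp_bernsteinTerm (m n : ℕ) :
    jacobiOp α β (bernsteinTerm m n) =
      -(C ((m : ℝ) * (m + α)) * bernsteinTerm (m - 1) (n + 1)
        + C (2 * m * n + (α + 1) * n + (β + 1) * m : ℝ) * bernsteinTerm m n
        + C ((n : ℝ) * (n + β)) * bernsteinTerm (m + 1) (n - 1)) := by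
  refine Polynomial.funext fun x => ?_
  rcases m with _ | _ | m <;> rcases n with _ | _ | n <;>
    simp [jacobiOp, bernsteinTerm, derivative_pow] <;> ring

/-- The Jacobi polynomial as an element of `ℝ[X]`. -/
noncomputable def jacobiPoly (α β : ℝ) (k : ℕ) : ℝ[X] :=
  ∑ s ∈ Finset.range (k + 1), C (jacobiCoeff α β k s) * bernsteinTerm s (k - s)

theorem jacobiP_eq_eval (k : ℕ) (x : ℝ) : jacobiP α β k x = (jacobiPoly α β k).eval x := by
  simp only [jacobiP, jacobiPoly, eval_finsetSum, jacobiCoeff, bernsteinTerm]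
  refine Finset.sum_congr rfl fun s _ => ?_
  simp
  ring

theorem jacobiOp_jacobiPoly (hα : -1 < α) (hβ : -1 < β) (k : ℕ) :
    jacobiOp α β (jacobiPoly α β k) = -(C ((k : ℝ) * (k + α + β + 1)) * jacobiPoly α β k) := by
  have lower : ∑ s ∈ Finset.range (k + 1), C (jacobiCoeff α β k s) *
      (C ((s : ℝ) * (s + α)) * bernsteinTerm (s - 1) (k - s + 1)) =
      ∑ s ∈ Finset.range (k + 1), C (jacobiCoeff α β k s) *
      (C (((k : ℝ) - s) * (k - s + β)) * bernsteinTerm s (k - s)) := by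
    rw [Finset.sum_range_succ', Finset.sum_range_succ]
    simp only [Nat.cast_zero, zero_mul, C_0, mul_zero, add_zero, sub_self]
    refine Finset.sum_congr rfl fun s hs => ?_
    have hs := Finset.mem_range.1 hs
    rw [← mul_assoc, ← mul_assoc, ← C_mul, ← C_mul, Nat.add_sub_cancel,
      show k - (s + 1) + 1 = k - s by omega]
    congr 2
    have := jacobiCoeff_succ hα hβ hs
    push_cast
    linear_combination this
  have upper : ∑ s ∈ Finset.range (k + 1), C (jacobiCoeff α β k s) *
      (C (((k - s : ℕ) : ℝ) * ((k - s : ℕ) + β)) * bernsteinTerm (s + 1) (k - s - 1)) =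
      ∑ s ∈ Finset.range (k + 1), C (jacobiCoeff α β k s) *
      (C ((s : ℝ) * (s + α)) * bernsteinTerm s (k - s)) := by
    rw [Finset.sum_range_succ, Finset.sum_range_succ']
    simp only [Nat.cast_zero, zero_mul, C_0, mul_zero, add_zero, Nat.sub_self]
    refine Finset.sum_congr rfl fun s hs => ?_
    have hs := Finset.mem_range.1 hs
    rw [← mul_assoc, ← mul_assoc, ← C_mul, ← C_mul, Nat.sub_sub, Nat.cast_sub hs.le]
    congr 2
    have := jacobiCoeff_succ hα hβ hs
    push_cast
    linear_combination -this
  rw [jacobiPoly, jacobiOp_sum]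
  have expand : ∀ a b c d : ℝ[X], a * -(b + c + d) = -(a * b + a * c + a * d) := fun _ _ _ _ => by
    ring
  simp only [jacobiOp_bernsteinTerm, expand, Finset.sum_neg_distrib, Finset.sum_add_distrib]
  rw [lower, upper, ← Finset.sum_add_distrib, ← Finset.sum_add_distrib, Finset.mul_sum]
  congr 1
  refine Finset.sum_congr rfl fun s hs => ?_
  have hs : s ≤ k := Nat.lt_succ_iff.1 (Finset.mem_range.1 hs)
  rw [Nat.cast_sub hs]
  simp only [← mul_assoc, ← C_mul, ← add_mul, ← C_add]
  congr 2
  ring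

theorem eval_one_jacobiPoly (k : ℕ) :
    (jacobiPoly α β k).eval 1 = genBinom (k + α) k * genBinom (k + β) 0 := by
  rw [jacobiPoly, Finset.sum_range_succ', eval_add, eval_finsetSum, Finset.sum_eq_zero]
  · simp [jacobiCoeff, bernsteinTerm]; norm_num
  · intro s _
    simp [bernsteinTerm]

theorem eval_neg_one_jacobiPoly (k : ℕ) :
    (jacobiPoly α β k).eval (-1) = genBinom (k + α) 0 * genBinom (k + β) k * (-1) ^ k := by
  rw [jacobiPoly, Finset.sum_range_succ, eval_add, eval_finsetSum, Finset.sum_eq_zero]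
  · simp [jacobiCoeff, bernsteinTerm]; norm_num
  · intro s hs
    have : k - s ≠ 0 := by have := Finset.mem_range.1 hs; omega
    simp [bernsteinTerm, this]

theorem genBinom_zero {a : ℝ} (ha : -1 < a) : genBinom a 0 = 1 := by
  have : Real.Gamma (a + 1) ≠ 0 := (Real.Gamma_pos_of_pos (by linarith)).ne'
  simp [genBinom, this]

/-- Growth of the diagonal binomial coefficients. -/
theorem genBinom_add_self_isBigO (hα : -1 < α) :
    (fun k : ℕ => genBinom (k + α) k) =O[atTop] fun k : ℕ => (k : ℝ) ^ α := by
  have hs : 0 < α + 1 := by linarith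
  have hG : Real.Gamma (α + 1) ≠ 0 := (Real.Gamma_pos_of_pos hs).ne'
  have prod_eq : ∀ n : ℕ, Real.Gamma (α + 1 + n + 1) =
      (∏ j ∈ Finset.range (n + 1), (α + 1 + j)) * Real.Gamma (α + 1) := by
    intro n
    induction n with
    | zero => simp [Real.Gamma_add_one hs.ne']
    | succ n ih =>
      rw [Finset.prod_range_succ, Real.Gamma_add_one (by positivity)]
      push_cast at ih ⊢
      rw [← add_assoc, ih]; ring
  have key : ∀ᶠ n : ℕ in atTop, genBinom (n + α) n =
      (n / (α + 1 + n)) * (Real.GammaSeq (α + 1) n)⁻¹ * (n : ℝ) ^ α := by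
    filter_upwards [eventually_gt_atTop 0] with n hn
    have hn' : (0 : ℝ) < n := by exact_mod_cast hn
    have h1 := prod_eq n
    rw [Real.Gamma_add_one (by positivity)] at h1
    have h2 : (α + 1 + n : ℝ) ≠ 0 := by positivity
    have h3 : (n.factorial : ℝ) ≠ 0 := by positivity
    have h4 : ((n : ℝ) ^ α) ≠ 0 := by positivity
    have h5 : ∏ j ∈ Finset.range (n + 1), (α + 1 + j) ≠ 0 :=
      Finset.prod_ne_zero_iff.2 fun j _ => by positivity
    rw [genBinom, Real.GammaSeq, Real.rpow_add_one hn'.ne', Real.Gamma_nat_eq_factorial,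
      show (n : ℝ) + α + 1 = α + 1 + n by ring, show (n : ℝ) + α - n + 1 = α + 1 by ring]
    field_simp
    linear_combination h1
  refine Asymptotics.IsBigO.congr' ?_ (key.mono fun _ h => h.symm) EventuallyEq.rfl
  have lim : Tendsto (fun n : ℕ => ((n : ℝ) / (α + 1 + n)) * (Real.GammaSeq (α + 1) n)⁻¹) atTop
      (nhds (1 * (Real.Gamma (α + 1))⁻¹)) := by
    refine Tendsto.mul ?_ ((Real.GammaSeq_tendsto_Gamma _).inv₀ hG)
    simpa [add_comm] using tendsto_natCast_div_add_atTop (α + 1)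
  simpa using (lim.isBigO_one ℝ).mul (Asymptotics.isBigO_refl (fun n : ℕ => (n : ℝ) ^ α) atTop)

/-- Sonin argument: a Jacobi polynomial takes its largest modulus at an endpoint. -/
theorem abs_eval_jacobiPoly_le (hα : -1 < α) (hβ : -1 < β) (h : -(1 / 2) ≤ max α β)
    {k : ℕ} (hk : 0 < k) {x : ℝ} (hx : x ∈ Icc (-1 : ℝ) 1) :
    |(jacobiPoly α β k).eval x| ≤
      |(jacobiPoly α β k).eval 1| + |(jacobiPoly α β k).eval (-1)| := by
  set p := jacobiPoly α β k with hp
  have hk' : (1 : ℝ) ≤ k := by exact_mod_cast hk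
  set c : ℝ := k * (k + α + β + 1) with hc
  have hc0 : 0 < c := by have : 0 < (k : ℝ) + α + β + 1 := by linarith
                         positivity
  let F : ℝ[X] := C c * p ^ 2 + (1 - X ^ 2) * derivative p ^ 2
  let A : ℝ → ℝ := fun y => (α - β) + (α + β + 1) * y
  have dF : ∀ y, deriv (fun z => F.eval z) y = 2 * (derivative p).eval y ^ 2 * A y := by
    intro y
    have ode := congrArg (eval y) (jacobiOp_jacobiPoly hα hβ k)
    rw [← hp, ← hc] at ode
    simp only [jacobiOp, eval_add, eval_mul, eval_sub, eval_one, eval_pow, eval_X, eval_C,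
      eval_neg] at ode
    rw [Polynomial.deriv]
    simp only [F, A, derivative_add, derivative_mul, derivative_C, derivative_pow, derivative_sub,
      derivative_one, derivative_X, eval_add, eval_mul, eval_sub, eval_one, eval_pow, eval_X,
      eval_C, eval_zero]
    norm_num
    linear_combination 2 * eval y (derivative p) * ode
  have mono : ∀ a b, a ≤ b → (∀ y ∈ Icc a b, 0 ≤ A y) → F.eval a ≤ F.eval b := by
    intro a b hab hA
    refine monotoneOn_of_deriv_nonneg (convex_Icc a b) F.continuous.continuousOn
      F.differentiable.differentiableOn (fun y hy => ?_) (left_mem_Icc.2 hab)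
      (right_mem_Icc.2 hab) hab
    rw [dF]
    exact mul_nonneg (by positivity) (hA y (interior_subset hy))
  have anti : ∀ a b, a ≤ b → (∀ y ∈ Icc a b, A y ≤ 0) → F.eval b ≤ F.eval a := by
    intro a b hab hA
    refine antitoneOn_of_deriv_nonpos (convex_Icc a b) F.continuous.continuousOn
      F.differentiable.differentiableOn (fun y hy => ?_) (left_mem_Icc.2 hab)
      (right_mem_Icc.2 hab) hab
    rw [dF]
    exact mul_nonpos_of_nonneg_of_nonpos (by positivity) (hA y (interior_subset hy))
  have bound : F.eval x ≤ F.eval 1 ∨ F.eval x ≤ F.eval (-1) := by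
    obtain ⟨hx1, hx2⟩ := hx
    by_cases hA : 0 ≤ A x ∧ -(1 / 2) ≤ α
    · left
      refine mono x 1 hx2 fun y hy => ?_
      obtain ⟨hA, hα'⟩ := hA
      simp only [A] at hA ⊢
      by_cases hs : 0 ≤ α + β + 1
      · nlinarith [hy.1]
      · nlinarith [hy.2]
    · by_cases hB : A x ≤ 0 ∧ -(1 / 2) ≤ β
      · right
        refine anti (-1) x hx1 fun y hy => ?_
        obtain ⟨hB, hβ'⟩ := hB
        simp only [A] at hB ⊢
        by_cases hs : 0 ≤ α + β + 1
        · nlinarith [hy.2]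
        · nlinarith [hy.1]
      · exfalso
        simp only [A] at hA hB
        rcases le_max_iff.1 h with h | h
        · have hA' := lt_of_not_ge fun h' => hA ⟨h', h⟩
          have hB' := lt_of_not_ge fun h' => hB ⟨hA'.le, h'⟩
          nlinarith
        · have hB' := lt_of_not_ge fun h' => hB ⟨h', h⟩
          have hA' := lt_of_not_ge fun h' => hA ⟨hB'.le, h'⟩
          nlinarith
  have hF : c * p.eval x ^ 2 ≤ F.eval x := by
    simp only [F, eval_add, eval_mul, eval_C, eval_pow, eval_sub, eval_one, eval_X]
    nlinarith [hx.1, hx.2, mul_nonneg (show 0 ≤ 1 - x ^ 2 by nlinarith [hx.1, hx.2])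
      (sq_nonneg (eval x (derivative p)))]
  have endpoint : ∀ y : ℝ, y ^ 2 = 1 → F.eval y = c * p.eval y ^ 2 := by
    intro y hy
    simp [F, hy]
  rcases bound with hb | hb
  · rw [endpoint 1 (by norm_num)] at hb
    have := sq_le_sq.1 (le_of_mul_le_mul_left (hF.trans hb) hc0)
    linarith [abs_nonneg (p.eval (-1))]
  · rw [endpoint (-1) (by norm_num)] at hb
    have := sq_le_sq.1 (le_of_mul_le_mul_left (hF.trans hb) hc0)
    linarith [abs_nonneg (p.eval 1)]

/-- Uniform bound of Jacobi polynomials on `[-1, 1]`. -/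
theorem exists_abs_eval_jacobiPoly_le (hα : -1 < α) (hβ : -1 < β) (h : -(1 / 2) ≤ max α β) :
    ∃ M : ℝ, 0 < M ∧ ∀ᶠ k : ℕ in atTop, ∀ x ∈ Icc (-1 : ℝ) 1,
      |(jacobiPoly α β k).eval x| ≤ M * (k : ℝ) ^ max α β := by
  obtain ⟨A, hA, hA'⟩ := (genBinom_add_self_isBigO hα).exists_pos
  obtain ⟨B, hB, hB'⟩ := (genBinom_add_self_isBigO hβ).exists_pos
  refine ⟨A + B, by positivity, ?_⟩
  filter_upwards [hA'.bound, hB'.bound, eventually_gt_atTop 0] with k h1 h2 hk x hx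
  have hk' : (1 : ℝ) ≤ k := by exact_mod_cast hk
  have h0 : (0 : ℝ) ≤ k := by positivity
  refine (abs_eval_jacobiPoly_le hα hβ h hk hx).trans ?_
  rw [eval_one_jacobiPoly, eval_neg_one_jacobiPoly, genBinom_zero (by linarith),
    genBinom_zero (by linarith)]
  simp only [mul_one, one_mul, abs_mul, abs_pow, abs_neg, abs_one, one_pow]
  rw [Real.norm_eq_abs, Real.norm_of_nonneg (by positivity)] at h1 h2
  rw [add_mul]
  refine add_le_add (h1.trans ?_) (h2.trans ?_)
  · gcongr
    exact le_max_left _ _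
  · gcongr
    exact le_max_right _ _

theorem jacobiWeight_nonneg {θ : ℝ} (hθ : θ ∈ Icc 0 Real.pi) : 0 ≤ jacobiWeight α β θ := by
  have h1 : 0 ≤ Real.sin (θ / 2) :=
    Real.sin_nonneg_of_nonneg_of_le_pi (by linarith [hθ.1]) (by linarith [hθ.2, Real.pi_pos])
  have h2 : 0 ≤ Real.cos (θ / 2) :=
    Real.cos_nonneg_of_neg_pi_div_two_le_of_le (by linarith [hθ.1, Real.pi_pos])
      (by linarith [hθ.2])
  unfold jacobiWeight
  positivity

theorem sin_half_pos {θ : ℝ} (hθ : θ ∈ Ioo 0 Real.pi) : 0 < Real.sin (θ / 2) :=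
  Real.sin_pos_of_pos_of_lt_pi (by linarith [hθ.1]) (by linarith [hθ.2, Real.pi_pos])

theorem cos_half_pos {θ : ℝ} (hθ : θ ∈ Ioo 0 Real.pi) : 0 < Real.cos (θ / 2) :=
  Real.cos_pos_of_mem_Ioo ⟨by linarith [hθ.1, Real.pi_pos], by linarith [hθ.2]⟩

theorem hasDerivAt_sin_half (θ : ℝ) :
    HasDerivAt (fun x : ℝ => Real.sin (x / 2)) (Real.cos (θ / 2) / 2) θ := by
  simpa [div_eq_mul_inv] using ((hasDerivAt_id θ).div_const 2).sin

theorem hasDerivAt_cos_half (θ : ℝ) :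
    HasDerivAt (fun x : ℝ => Real.cos (x / 2)) (-(Real.sin (θ / 2) / 2)) θ := by
  simpa [div_eq_mul_inv] using ((hasDerivAt_id θ).div_const 2).cos

theorem continuous_sin_half_rpow {r : ℝ} (hr : 0 ≤ r) :
    Continuous fun x : ℝ => Real.sin (x / 2) ^ r :=
  (Real.continuous_sin.comp (continuous_id.div_const 2)).rpow_const fun _ => Or.inr hr

theorem continuous_cos_half_rpow {r : ℝ} (hr : 0 ≤ r) :
    Continuous fun x : ℝ => Real.cos (x / 2) ^ r :=
  (Real.continuous_cos.comp (continuous_id.div_const 2)).rpow_const fun _ => Or.inr hr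

theorem intervalIntegrable_jacobiWeight_left (hα : -1 < α) :
    IntervalIntegrable (jacobiWeight α β) volume 0 (Real.pi / 2) := by
  have hpi := Real.pi_pos
  have base : IntervalIntegrable
      (fun θ => Real.cos (θ / 2) / 2 * (2 * α + 2) * Real.sin (θ / 2) ^ (2 * α + 2 - 1))
      volume 0 (Real.pi / 2) := by
    refine intervalIntegral.intervalIntegrable_deriv_of_nonneg
      (g := fun θ => Real.sin (θ / 2) ^ (2 * α + 2))
      (continuous_sin_half_rpow (by linarith)).continuousOn (fun θ hθ => ?_) (fun θ hθ => ?_) <;>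
    rw [min_eq_left (by linarith), max_eq_right (by linarith)] at hθ <;>
    have hs := sin_half_pos (θ := θ) ⟨hθ.1, by linarith [hθ.2]⟩
    · exact (hasDerivAt_sin_half θ).rpow_const (Or.inl hs.ne')
    · have hc := cos_half_pos (θ := θ) ⟨hθ.1, by linarith [hθ.2]⟩
      have : 0 < 2 * α + 2 := by linarith
      positivity
  have hcos : ∀ θ ∈ uIcc 0 (Real.pi / 2), 0 < Real.cos (θ / 2) := by
    intro θ hθ
    rw [uIcc_of_le (by linarith)] at hθ
    exact Real.cos_pos_of_mem_Ioo ⟨by linarith [hθ.1], by linarith [hθ.2]⟩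
  have hcont : ContinuousOn (fun θ : ℝ => Real.cos (θ / 2) ^ (2 * β) * (α + 1)⁻¹)
      (uIcc 0 (Real.pi / 2)) := by
    refine ContinuousOn.mul (ContinuousOn.rpow_const ?_ fun θ hθ => Or.inl (hcos θ hθ).ne')
      continuousOn_const
    fun_prop
  refine (base.mul_continuousOn hcont).congr fun θ hθ => ?_
  have hc := hcos θ (uIoc_subset_uIcc hθ)
  have hα' : α + 1 ≠ 0 := by linarith
  rw [jacobiWeight, Real.rpow_add_one hc.ne', show 2 * α + 2 - 1 = 2 * α + 1 by ring]
  field_simp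

theorem intervalIntegrable_jacobiWeight (hα : -1 < α) (hβ : -1 < β) :
    IntervalIntegrable (jacobiWeight α β) volume 0 Real.pi := by
  refine (intervalIntegrable_jacobiWeight_left hα).trans ?_
  have h := (intervalIntegrable_jacobiWeight_left (β := α) hβ).comp_sub_left Real.pi
  have e : (fun x => jacobiWeight β α (Real.pi - x)) = jacobiWeight α β := by
    funext x
    rw [jacobiWeight, jacobiWeight, show (Real.pi - x) / 2 = Real.pi / 2 - x / 2 by ring,
      Real.sin_pi_div_two_sub, Real.cos_pi_div_two_sub, mul_comm]
  rw [e, sub_zero, show Real.pi - Real.pi / 2 = Real.pi / 2 by ring] at h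
  exact h.symm

theorem intervalIntegrable_eval_cos_mul_jacobiWeight (hα : -1 < α) (hβ : -1 < β) (p : ℝ[X]) :
    IntervalIntegrable (fun θ => p.eval (Real.cos θ) * jacobiWeight α β θ) volume 0 Real.pi :=
  (intervalIntegrable_jacobiWeight hα hβ).continuousOn_mul
    (p.continuous.comp Real.continuous_cos).continuousOn

/-- The Jacobi moment functional. -/
noncomputable def jacobiMoment (α β : ℝ) (p : ℝ[X]) : ℝ :=
  ∫ θ in (0 : ℝ)..Real.pi, p.eval (Real.cos θ) * jacobiWeight α β θ

theorem jacobiMoment_add (hα : -1 < α) (hβ : -1 < β) (p q : ℝ[X]) :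
    jacobiMoment α β (p + q) = jacobiMoment α β p + jacobiMoment α β q := by
  simp only [jacobiMoment, eval_add, add_mul]
  exact intervalIntegral.integral_add (intervalIntegrable_eval_cos_mul_jacobiWeight hα hβ p)
    (intervalIntegrable_eval_cos_mul_jacobiWeight hα hβ q)

theorem jacobiMoment_C_mul (c : ℝ) (p : ℝ[X]) :
    jacobiMoment α β (C c * p) = c * jacobiMoment α β p := by
  simp only [jacobiMoment, eval_mul, eval_C, mul_assoc]
  exact intervalIntegral.integral_const_mul _ _

/-- The Jacobi operator is symmetric for the Jacobi weight. -/
theorem jacobiMoment_jacobiOp_symm (hα : -1 < α) (hβ : -1 < β) (p q : ℝ[X]) :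
    jacobiMoment α β (jacobiOp α β p * q) = jacobiMoment α β (p * jacobiOp α β q) := by
  let g : ℝ[X] := derivative p * q - p * derivative q
  let W : ℝ → ℝ := fun θ => Real.sin (θ / 2) ^ (2 * α + 2) * Real.cos (θ / 2) ^ (2 * β + 2)
  let D : ℝ[X] := C (-1 / 2) * (jacobiOp α β p * q + C (-1) * (p * jacobiOp α β q))
  have hderiv : ∀ θ ∈ Ioo 0 Real.pi, HasDerivAt (fun θ => W θ * g.eval (Real.cos θ))
      (D.eval (Real.cos θ) * jacobiWeight α β θ) θ := by
    intro θ hθ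
    have hs := sin_half_pos hθ
    have hc := cos_half_pos hθ
    have h1 := (hasDerivAt_sin_half θ).rpow_const (p := 2 * α + 2) (Or.inl hs.ne')
    have h2 := (hasDerivAt_cos_half θ).rpow_const (p := 2 * β + 2) (Or.inl hc.ne')
    have h3 := (g.hasDerivAt (Real.cos θ)).comp θ (Real.hasDerivAt_cos θ)
    refine ((h1.mul h2).mul h3).congr_deriv ?_
    have es : Real.sin (θ / 2) ^ (2 * α + 2) =
        Real.sin (θ / 2) ^ (2 * α + 1) * Real.sin (θ / 2) := by
      rw [← Real.rpow_add_one hs.ne']; ring_nf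
    have ec : Real.cos (θ / 2) ^ (2 * β + 2) =
        Real.cos (θ / 2) ^ (2 * β + 1) * Real.cos (θ / 2) := by
      rw [← Real.rpow_add_one hc.ne']; ring_nf
    have sin_eq : Real.sin θ = 2 * Real.sin (θ / 2) * Real.cos (θ / 2) := by
      rw [← Real.sin_two_mul]; ring_nf
    have sin_sq : Real.sin (θ / 2) ^ 2 = (1 - Real.cos θ) / 2 := by
      rw [Real.sin_sq, Real.cos_sq]; ring_nf
    have cos_sq : Real.cos (θ / 2) ^ 2 = (1 + Real.cos θ) / 2 := by
      rw [Real.cos_sq]; ring_nf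
    simp only [Pi.mul_apply, Function.comp_apply, es, ec, sin_eq,
      show 2 * α + 2 - 1 = 2 * α + 1 by ring, show 2 * β + 2 - 1 = 2 * β + 1 by ring, D, g,
      jacobiOp, jacobiWeight, derivative_sub, derivative_mul, eval_add, eval_sub, eval_mul, eval_C,
      eval_one, eval_pow, eval_X]
    generalize Real.sin (θ / 2) ^ (2 * α + 1) = s'
    generalize Real.cos (θ / 2) ^ (2 * β + 1) = c'
    generalize Real.sin (θ / 2) = s at *
    generalize Real.cos (θ / 2) = c at *
    generalize Real.cos θ = x at *
    have hx : x = 1 - 2 * s ^ 2 := by linear_combination 2 * sin_sq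
    have hc2 : c ^ 2 = 1 - s ^ 2 := by linear_combination cos_sq + sin_sq
    generalize eval x p = p0
    generalize eval x q = q0
    generalize eval x (derivative p) = p1
    generalize eval x (derivative q) = q1
    generalize eval x (derivative (derivative p)) = p2
    generalize eval x (derivative (derivative q)) = q2
    subst hx
    linear_combination (s' * c') * ((α + 1) * (p1 * q0 - p0 * q1)
      - 2 * s ^ 2 * (p2 * q0 - p0 * q2)) * hc2
  have hcont : ContinuousOn (fun θ => W θ * g.eval (Real.cos θ)) (Icc 0 Real.pi) :=
    (((continuous_sin_half_rpow (by linarith)).mul (continuous_cos_half_rpow (by linarith))).mul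
      (g.continuous.comp Real.continuous_cos)).continuousOn
  have ftc := intervalIntegral.integral_eq_sub_of_hasDerivAt_of_le Real.pi_pos.le hcont hderiv
    (intervalIntegrable_eval_cos_mul_jacobiWeight hα hβ D)
  have hW0 : W 0 = 0 := by
    simp [W, Real.zero_rpow (show 2 * α + 2 ≠ 0 by linarith)]
  have hWpi : W Real.pi = 0 := by
    simp [W, Real.zero_rpow (show 2 * β + 2 ≠ 0 by linarith)]
  have hD : jacobiMoment α β D = 0 := by
    rw [jacobiMoment, ftc, hW0, hWpi]; ring
  simp only [D] at hD
  rw [jacobiMoment_C_mul, jacobiMoment_add hα hβ, jacobiMoment_C_mul] at hD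
  linarith

theorem jacobiOp_X_pow (m : ℕ) :
    jacobiOp α β (X ^ m) = -(C ((m : ℝ) * (m + α + β + 1)) * X ^ m)
      + C ((β - α) * m) * X ^ (m - 1) + C ((m : ℝ) * (m - 1)) * X ^ (m - 2) := by
  refine Polynomial.funext fun x => ?_
  rcases m with _ | _ | m <;> simp [jacobiOp] <;> ring

/-- A Jacobi polynomial is orthogonal to all monomials of smaller degree. -/
theorem jacobiMoment_X_pow_mul_jacobiPoly (hα : -1 < α) (hβ : -1 < β) (k m : ℕ) (hm : m < k) :
    jacobiMoment α β (X ^ m * jacobiPoly α β k) = 0 := by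
  induction m using Nat.strong_induction_on with
  | _ m ih =>
    set P := jacobiPoly α β k with hP
    have symm := jacobiMoment_jacobiOp_symm hα hβ (X ^ m) P
    rw [hP, jacobiOp_jacobiPoly hα hβ, ← hP, jacobiOp_X_pow] at symm
    have h1 : (β - α) * m * jacobiMoment α β (X ^ (m - 1) * P) = 0 := by
      rcases m with _ | m
      · simp
      · rw [ih (m + 1 - 1) (by omega) (by omega), mul_zero]
    have h2 : (m : ℝ) * (m - 1) * jacobiMoment α β (X ^ (m - 2) * P) = 0 := by
      rcases m with _ | m
      · simp
      · rw [ih (m + 1 - 2) (by omega) (by omega), mul_zero]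
    have e1 : (-(C ((m : ℝ) * (m + α + β + 1)) * X ^ m)
      + C ((β - α) * m) * X ^ (m - 1) + C ((m : ℝ) * (m - 1)) * X ^ (m - 2)) * P =
      C (-((m : ℝ) * (m + α + β + 1))) * (X ^ m * P) + C ((β - α) * m) * (X ^ (m - 1) * P)
      + C ((m : ℝ) * (m - 1)) * (X ^ (m - 2) * P) := by
      rw [C_neg]; ring
    have e2 : X ^ m * -(C ((k : ℝ) * (k + α + β + 1)) * P) =
        C (-((k : ℝ) * (k + α + β + 1))) * (X ^ m * P) := by
      rw [C_neg]; ring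
    rw [e1, e2, jacobiMoment_add hα hβ, jacobiMoment_add hα hβ, jacobiMoment_C_mul,
      jacobiMoment_C_mul, jacobiMoment_C_mul, jacobiMoment_C_mul, h1, h2] at symm
    have hkm : (m : ℝ) + 1 ≤ k := by exact_mod_cast hm
    have hm0 : (0 : ℝ) ≤ m := m.cast_nonneg
    have hpos : 0 < ((k : ℝ) - m) * (k + m + α + β + 1) :=
      mul_pos (by linarith) (by linarith)
    refine (mul_eq_zero.1 ?_).resolve_left hpos.ne'
    linear_combination symm

theorem jacobiMoment_mul_jacobiPoly (hα : -1 < α) (hβ : -1 < β) {k : ℕ} (p : ℝ[X])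
    (hp : p.natDegree < k) : jacobiMoment α β (p * jacobiPoly α β k) = 0 := by
  have key : ∀ n ≤ k, jacobiMoment α β
      ((∑ i ∈ Finset.range n, C (p.coeff i) * X ^ i) * jacobiPoly α β k) = 0 := by
    intro n
    induction n with
    | zero => intro _; simp [jacobiMoment]
    | succ n ih =>
      intro hn
      rw [Finset.sum_range_succ, add_mul, jacobiMoment_add hα hβ, ih (by omega), mul_assoc,
        jacobiMoment_C_mul, jacobiMoment_X_pow_mul_jacobiPoly hα hβ k n (by omega), mul_zero,
        add_zero]
  have := key (p.natDegree + 1) hp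
  rwa [← p.as_sum_range_C_mul_X_pow] at this

/-- Polynomials in `cos θ` are dense in the weighted `L¹` space. -/
theorem exists_polynomial_integral_sub_le (hα : -1 < α) (hβ : -1 < β) {f : ℝ → ℝ}
    (hf : MemJacobiL α β f) {ε : ℝ} (hε : 0 < ε) :
    ∃ p : ℝ[X], ∫ θ in Ioc (0 : ℝ) Real.pi,
      |f θ - p.eval (Real.cos θ)| * jacobiWeight α β θ ≤ ε := by
  have hw : IntegrableOn (jacobiWeight α β) (Ioc 0 Real.pi) :=
    (intervalIntegrable_iff_integrableOn_Ioc_of_le Real.pi_pos.le).1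
      (intervalIntegrable_jacobiWeight hα hβ)
  have hwm : AEMeasurable (fun θ => ENNReal.ofReal (jacobiWeight α β θ))
      (volume.restrict (Ioc 0 Real.pi)) := hw.aemeasurable.ennreal_ofReal
  have htop : ∀ᵐ θ ∂(volume.restrict (Ioc 0 Real.pi)),
      ENNReal.ofReal (jacobiWeight α β θ) < ⊤ := ae_of_all _ fun _ => ENNReal.ofReal_lt_top
  have htoReal : ∀ θ ∈ Ioc 0 Real.pi,
      (ENNReal.ofReal (jacobiWeight α β θ)).toReal = jacobiWeight α β θ := fun θ hθ =>
    ENNReal.toReal_ofReal (jacobiWeight_nonneg (Ioc_subset_Icc_self hθ))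
  let μ : Measure ℝ := (volume.restrict (Ioc 0 Real.pi)).withDensity
    fun θ => ENNReal.ofReal (jacobiWeight α β θ)
  have : IsFiniteMeasure μ := isFiniteMeasure_withDensity_ofReal hw.hasFiniteIntegral
  have hfμ : Integrable f μ := by
    refine (integrable_withDensity_iff_integrable_smul₀' hwm htop).2 (hf.congr ?_)
    filter_upwards [ae_restrict_mem measurableSet_Ioc] with θ hθ
    rw [htoReal θ hθ, smul_eq_mul, mul_comm]
  have integral_eq : ∀ g : ℝ → ℝ,
      ∫ θ, g θ ∂μ = ∫ θ in Ioc (0 : ℝ) Real.pi, g θ * jacobiWeight α β θ := by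
    intro g
    rw [integral_withDensity_eq_integral_toReal_smul₀ hwm htop]
    refine setIntegral_congr_fun measurableSet_Ioc fun θ hθ => ?_
    simp only [htoReal θ hθ, smul_eq_mul, mul_comm]
  obtain ⟨g, hg, hgi⟩ := hfμ.exists_boundedContinuous_integral_sub_le (half_pos hε)
  have hm : 0 < 2 * (μ.real univ + 1) := by positivity
  obtain ⟨p, hp⟩ := exists_polynomial_near_of_continuousOn (-1) 1 (fun x => g (Real.arccos x))
    (g.continuous.comp Real.continuous_arccos).continuousOn (ε / (2 * (μ.real univ + 1)))
    (by positivity)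
  refine ⟨p, ?_⟩
  rw [← integral_eq fun θ => |f θ - p.eval (Real.cos θ)|]
  have hae : ∀ᵐ θ ∂μ, θ ∈ Ioc 0 Real.pi :=
    (withDensity_absolutelyContinuous _ _).ae_le (ae_restrict_mem measurableSet_Ioc)
  have hnear : ∀ᵐ θ ∂μ, |f θ - p.eval (Real.cos θ)| ≤
      ‖f θ - g θ‖ + ε / (2 * (μ.real univ + 1)) := by
    filter_upwards [hae] with θ hθ
    have h1 := hp (Real.cos θ) ⟨Real.neg_one_le_cos θ, Real.cos_le_one θ⟩
    simp only [Real.arccos_cos hθ.1.le hθ.2] at h1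
    rw [abs_sub_comm] at h1
    calc _ ≤ |f θ - g θ| + |g θ - p.eval (Real.cos θ)| := abs_sub_le _ _ _
      _ ≤ _ := by rw [Real.norm_eq_abs]; linarith
  have hi1 : Integrable (fun θ => ‖f θ - g θ‖) μ := (hfμ.sub hgi).norm
  calc ∫ θ, |f θ - p.eval (Real.cos θ)| ∂μ
      ≤ ∫ θ, (‖f θ - g θ‖ + ε / (2 * (μ.real univ + 1))) ∂μ :=
        integral_mono_of_nonneg (ae_of_all _ fun _ => abs_nonneg _)
          (hi1.add (integrable_const _)) hnear
    _ = ∫ θ, ‖f θ - g θ‖ ∂μ + μ.real univ * (ε / (2 * (μ.real univ + 1))) := by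
        rw [integral_add hi1 (integrable_const _), integral_const, smul_eq_mul]
    _ ≤ ε / 2 + ε / 2 := by
        refine add_le_add hg ?_
        have h0 : 0 ≤ μ.real univ := measureReal_nonneg
        rw [← mul_div_assoc, div_le_div_iff₀ hm two_pos]
        nlinarith
    _ = ε := add_halves ε

end Jacobi

open Asymptotics in
/-- For `α, β > -1` with `max {α, β} ≥ -1/2` and `f ∈ L_{(α,β)}`,
`∫_0^π f(θ) P_k^{(α,β)}(cos θ) (sin(θ/2))^{2α+1} (cos(θ/2))^{2β+1} dθ = o(k^{max{α,β}})`. -/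
theorem jacobi_unnormalized_coeff_isLittleO (α β : ℝ) (hα : -1 < α) (hβ : -1 < β)
    (h : -(1/2) ≤ max α β) (f : ℝ → ℝ) (hf : MemJacobiL α β f) :
    (fun k : ℕ =>
        ∫ θ in Ioc (0 : ℝ) Real.pi,
          f θ * jacobiP α β k (Real.cos θ) * jacobiWeight α β θ)
      =o[atTop] fun k : ℕ => (k : ℝ) ^ max α β := by
  obtain ⟨M, hM, hbound⟩ := exists_abs_eval_jacobiPoly_le hα hβ h
  refine isLittleO_iff.2 fun ε hε => ?_
  obtain ⟨p, hp⟩ := exists_polynomial_integral_sub_le hα hβ hf (div_pos hε hM)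
  filter_upwards [hbound, eventually_gt_atTop p.natDegree] with k hk hkp
  have hq : ∀ q : Polynomial ℝ,
      IntegrableOn (fun θ => q.eval (Real.cos θ) * jacobiWeight α β θ) (Ioc 0 Real.pi) := fun q =>
    (intervalIntegrable_iff_integrableOn_Ioc_of_le Real.pi_pos.le).1
      (intervalIntegrable_eval_cos_mul_jacobiWeight hα hβ q)
  have hsub : IntegrableOn (fun θ => (f θ - p.eval (Real.cos θ)) * jacobiWeight α β θ)
      (Ioc 0 Real.pi) := by
    simp only [sub_mul]
    exact hf.sub (hq p)
  have hbd : ∀ θ, ‖(jacobiPoly α β k).eval (Real.cos θ)‖ ≤ M * (k : ℝ) ^ max α β := fun θ =>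
    hk _ ⟨Real.neg_one_le_cos θ, Real.cos_le_one θ⟩
  have hmul : IntegrableOn (fun θ => (jacobiPoly α β k).eval (Real.cos θ) *
      ((f θ - p.eval (Real.cos θ)) * jacobiWeight α β θ)) (Ioc 0 Real.pi) :=
    hsub.bdd_mul ((jacobiPoly α β k).continuous.comp
      Real.continuous_cos).aestronglyMeasurable (ae_of_all _ hbd)
  have orth : ∫ θ in Ioc 0 Real.pi,
      (p * jacobiPoly α β k).eval (Real.cos θ) * jacobiWeight α β θ = 0 := by
    rw [← intervalIntegral.integral_of_le Real.pi_pos.le]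
    exact jacobiMoment_mul_jacobiPoly hα hβ p hkp
  have split : ∫ θ in Ioc (0 : ℝ) Real.pi, f θ * jacobiP α β k (Real.cos θ) * jacobiWeight α β θ =
      ∫ θ in Ioc (0 : ℝ) Real.pi, (jacobiPoly α β k).eval (Real.cos θ) *
        ((f θ - p.eval (Real.cos θ)) * jacobiWeight α β θ) := by
    refine Eq.trans ?_ ((integral_add hmul (hq (p * jacobiPoly α β k))).trans
      (by rw [orth, add_zero]))
    refine integral_congr_ae (ae_of_all _ fun θ => ?_)
    simp only [jacobiP_eq_eval, Polynomial.eval_mul]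
    ring
  have hnorm : IntegrableOn (fun θ => |f θ - p.eval (Real.cos θ)| * jacobiWeight α β θ)
      (Ioc 0 Real.pi) := by
    refine hsub.norm.congr ?_
    filter_upwards [ae_restrict_mem measurableSet_Ioc] with θ hθ
    rw [norm_mul, Real.norm_eq_abs,
      Real.norm_of_nonneg (jacobiWeight_nonneg (Ioc_subset_Icc_self hθ))]
  have hk0 : 0 ≤ (k : ℝ) ^ max α β := by positivity
  rw [split, Real.norm_of_nonneg hk0]
  calc _ ≤ ∫ θ in Ioc (0 : ℝ) Real.pi, M * (k : ℝ) ^ max α β *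
        (|f θ - p.eval (Real.cos θ)| * jacobiWeight α β θ) := by
        refine norm_integral_le_of_norm_le (hnorm.const_mul _) ?_
        filter_upwards [ae_restrict_mem measurableSet_Ioc] with θ hθ
        have hw : 0 ≤ jacobiWeight α β θ := jacobiWeight_nonneg (Ioc_subset_Icc_self hθ)
        rw [norm_mul, norm_mul, Real.norm_of_nonneg hw, Real.norm_eq_abs (f θ - _)]
        exact mul_le_mul_of_nonneg_right (hbd θ) (by positivity)
    _ ≤ M * (k : ℝ) ^ max α β * (ε / M) := by
        rw [integral_const_mul]
        exact mul_le_mul_of_nonneg_left hp (by positivity)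
    _ = ε * (k : ℝ) ^ max α β := by field_simp
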